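/- arXiv:math/0409105 — 2 statements merged into one kernel-verified Lean document; each statement's English description precedes it below -/
import Mathlib

section
/- For all positive integers k and p, the number of domino tilings of the region T(k,k+1,p) is even if p > 1 and k is even, and is odd if p = 1 or k is odd. -/
/-- Two cells of `ℤ × ℤ` are adjacent if they differ by `(1,0)` or `(0,1)`. -/
def Adjacent (a b : ℤ × ℤ) : Prop :=
  (a.1 = b.1 ∧ (a.2 = b.2 + 1 ∨ b.2 = a.2 + 1)) ∨
  (a.2 = b.2 ∧ (a.1 = b.1 + 1 ∨ b.1 = a.1 + 1))

/-- `T` is a domino tiling of `R`: a partition of `R` into two-element sets of adjacent cells. -/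
def IsDominoTiling (R : Set (ℤ × ℤ)) (T : Set (Set (ℤ × ℤ))) : Prop :=
  (∀ d ∈ T, ∃ a b, Adjacent a b ∧ d = {a, b}) ∧
  T.PairwiseDisjoint id ∧
  ⋃₀ T = R

/-- The number of domino tilings of `R`. -/
noncomputable def numTilings (R : Set (ℤ × ℤ)) : ℕ :=
  Nat.card {T : Set (Set (ℤ × ℤ)) // IsDominoTiling R T}

/-- The region `T(i,j,p)`: rows `r = 0, …, i+p-2` from top to bottom of lengths
`j, j+2, …, j+2(p-2)` followed by `i` rows of length `j+2(p-1)`, centers aligned. -/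
def Treg (i j p : ℕ) : Set (ℤ × ℤ) :=
  {q | 0 ≤ q.2 ∧ q.2 ≤ (i : ℤ) + p - 2 ∧
    (p : ℤ) - 1 - min q.2 ((p : ℤ) - 1) ≤ q.1 ∧
    q.1 ≤ (p : ℤ) - 2 + j + min q.2 ((p : ℤ) - 1)}

theorem rect_sum (φ : ℤ → ℤ → ZMod 2) (x y : ℤ) (a b : ℕ)
    (h : ∀ i j : ℤ, 0 ≤ i → i < a → 0 ≤ j → j < b →
      φ (x+i) (y+j) + φ (x+i+1) (y+j) + φ (x+i) (y+j+1) + φ (x+i+1) (y+j+1) = 0) :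
    φ x y + φ (x+a) y + φ x (y+b) + φ (x+a) (y+b) = 0 := by
  have two : ∀ z : ZMod 2, z + z = 0 := by decide
  have key : ∀ p q r s t u : ZMod 2, p + q + r + s = 0 → q + t + s + u = 0 →
      p + t + r + u = 0 := by decide
  have col : ∀ i : ℤ, 0 ≤ i → i < a → ∀ c : ℕ, c ≤ b →
      φ (x+i) y + φ (x+i) (y+c) + φ (x+i+1) y + φ (x+i+1) (y+c) = 0 := by
    intro i hi hia c
    induction c with
    | zero =>
      intro _
      have := two (φ (x+i) y); have h2 := two (φ (x+i+1) y)
      simp only [Nat.cast_zero, add_zero]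
      rw [this, zero_add, h2]
    | succ c ih =>
      intro hc
      have h1 := ih (by omega)
      have h2 := h i c hi hia (by omega) (by omega)
      push_cast
      rw [← add_assoc y]
      refine key _ _ _ _ _ _ h1 ?_
      rw [← h2]; ring
  have row : ∀ c : ℕ, c ≤ a → φ x y + φ (x+c) y + φ x (y+b) + φ (x+c) (y+b) = 0 := by
    intro c
    induction c with
    | zero =>
      intro _
      have := two (φ x y); have h2 := two (φ x (y+b))
      simp only [Nat.cast_zero, add_zero]
      rw [this, zero_add, h2]
    | succ c ih =>
      intro hc
      have h1 := ih (by omega)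
      have h2 := col c (by omega) (by omega) b le_rfl
      push_cast
      rw [← add_assoc x]
      refine key _ _ _ _ _ _ h1 ?_
      rw [← h2]; ring
  exact row a le_rfl

/-- integer-endpoint version -/
theorem rect_sum' (φ : ℤ → ℤ → ZMod 2) (x y x' y' : ℤ) (hx : x ≤ x') (hy : y ≤ y')
    (h : ∀ i j : ℤ, x ≤ i → i < x' → y ≤ j → j < y' →
      φ i j + φ (i+1) j + φ i (j+1) + φ (i+1) (j+1) = 0) :
    φ x y + φ x' y + φ x y' + φ x' y' = 0 := by
  have := rect_sum φ x y (x'-x).toNat (y'-y).toNat (by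
    intro i j h1 h2 h3 h4
    exact h (x+i) (y+j) (by omega) (by omega) (by omega) (by omega))
  have e1 : x + ((x'-x).toNat : ℤ) = x' := by omega
  have e2 : y + ((y'-y).toNat : ℤ) = y' := by omega
  rwa [e1, e2] at this

theorem ker_odd (m p : ℤ) (hm : 1 ≤ m) (hp : 1 ≤ p) (φ : ℤ → ℤ → ZMod 2)
    (rel : ∀ x y : ℤ, 0 ≤ x → y ≤ m - 1 → 0 ≤ x - y → x - y ≤ p + 2*m - 3 → 0 ≤ p + x + y →
      p + x + y ≤ 2*p + 2*m - 3 →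
      φ x y + φ (x+1) y + φ x (y+1) + φ (x+1) (y+1) = 0)
    (z1 : ∀ x y, x - y = -1 → φ x y = 0)
    (z2 : ∀ x y, x - y = p + 2*m - 2 → φ x y = 0)
    (z3 : ∀ x y, x + y = -p → φ x y = 0)
    (z4 : ∀ x y, x + y = p + 2*m - 1 → φ x y = 0)
    (z5 : ∀ x y, y = m → x ≤ p + m - 1 → φ x y = 0)
    (x y : ℤ) (hx : 0 ≤ x) (hy : y ≤ m) (h1 : -1 ≤ x - y) (h2 : x - y ≤ p + 2*m - 2)
    (h3 : -p ≤ x + y) (h4 : x + y ≤ p + 2*m - 1) (h5 : -p - m + 2 ≤ y) : φ x y = 0 := by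
  obtain ⟨g, hg⟩ : ∃ g : ℤ → ZMod 2, ∀ x, g x = φ x 0 := ⟨_, fun _ => rfl⟩
  obtain ⟨h, hh⟩ : ∃ h : ℤ → ZMod 2, ∀ y, h y = φ m y + φ m 0 := ⟨_, fun _ => rfl⟩
  have k1 : ∀ a b c d : ZMod 2, a + b + c + d = 0 → a = b + (c + d) := by decide
  have k2 : ∀ a b : ZMod 2, 0 = a + b → a = b := by decide
  have two : ∀ z : ZMod 2, z + z = 0 := by decide
  have dec : ∀ x y, 0 ≤ x → y ≤ m → -1 ≤ x - y → x - y ≤ p + 2*m - 2 → -p ≤ x + y →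
      x + y ≤ p + 2*m - 1 → -p - m + 2 ≤ y → φ x y = g x + h y := by
    intro x y hx hy h1 h2 h3 h4 h5
    rw [hg, hh]
    apply k1
    rcases le_total x m with a | a <;> rcases le_total y 0 with b | b
    · rw [← rect_sum' φ x y m 0 a b (fun i j _ _ _ _ => rel i j (by omega) (by omega) (by omega)
        (by omega) (by omega) (by omega))]; ring
    · rw [← rect_sum' φ x 0 m y a b (fun i j _ _ _ _ => rel i j (by omega) (by omega) (by omega)
        (by omega) (by omega) (by omega))]; ring
    · rw [← rect_sum' φ m y x 0 a b (fun i j _ _ _ _ => rel i j (by omega) (by omega) (by omega)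
        (by omega) (by omega) (by omega))]; ring
    · rw [← rect_sum' φ m 0 x y a b (fun i j _ _ _ _ => rel i j (by omega) (by omega) (by omega)
        (by omega) (by omega) (by omega))]; ring
  have top : ∀ x, 0 ≤ x → x ≤ m - 1 → g x = h (x+1) := fun x a b => k2 _ _ (by
    rw [← dec x (x+1) (by omega) (by omega) (by omega) (by omega) (by omega) (by omega) (by omega)]
    exact (z1 _ _ (by omega)).symm)
  have stair : ∀ x, m - 1 ≤ x → x ≤ p + m - 1 → g x = h m := fun x a b => k2 _ _ (by
    rw [← dec x m (by omega) (by omega) (by omega) (by omega) (by omega) (by omega) (by omega)]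
    exact (z5 _ _ rfl (by omega)).symm)
  have right : ∀ x, 0 ≤ x → x ≤ m - 1 → g (p+2*m-2-x) = h (x+1) := fun x a b => k2 _ _ (by
    rw [← dec _ _ (by omega) (by omega) (by omega) (by omega) (by omega) (by omega) (by omega)]
    exact (z4 _ _ (by omega)).symm)
  have bot : ∀ y, -p - m + 2 ≤ y → y ≤ 0 → g (y+p+2*m-2) = h y := fun y a b => k2 _ _ (by
    rw [← dec _ _ (by omega) (by omega) (by omega) (by omega) (by omega) (by omega) (by omega)]
    exact (z2 _ _ (by omega)).symm)
  have left : ∀ x, 0 ≤ x → x ≤ m - 2 → g x = h (-p-x) := fun x a b => k2 _ _ (by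
    rw [← dec _ _ (by omega) (by omega) (by omega) (by omega) (by omega) (by omega) (by omega)]
    exact (z3 _ _ (by omega)).symm)
  have A : ∀ n : ℕ, ∀ x : ℤ, 0 ≤ x → x ≤ m - 1 → m - 1 - x = n → g x = h m := by
    intro n
    induction n using Nat.strong_induction_on with
    | _ n ih =>
      intro x hx hx1 hn
      rcases eq_or_lt_of_le hx1 with e | e
      · exact stair x (by omega) (by omega)
      rw [left x hx (by omega), ← bot _ (by omega) (by omega)]
      rcases le_or_gt (x + p) (m-1) with c | c
      · have := right (x+p) (by omega) c
        rw [← top (x+p) (by omega) c] at this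
        rw [show -p - x + p + 2*m - 2 = p + 2*m-2-(x+p) by ring, this]
        exact ih (m-1-(x+p)).toNat (by omega) _ (by omega) c (by omega)
      · exact stair _ (by omega) (by omega)
  have A' : ∀ x : ℤ, 0 ≤ x → x ≤ m - 1 → g x = h m := fun x a b =>
    A (m-1-x).toNat x a b (by omega)
  have G : ∀ x : ℤ, 0 ≤ x → x ≤ p + 2*m-2 → g x = h m := by
    intro x a b
    rcases le_or_gt x (m-1) with c | c
    · exact A' x a c
    rcases le_or_gt x (p+m-1) with d | d
    · exact stair x (by omega) d
    have := right (p+2*m-2-x) (by omega) (by omega)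
    rw [← top (p+2*m-2-x) (by omega) (by omega), A' (p+2*m-2-x) (by omega) (by omega)] at this
    rw [← this]; congr 1; ring
  have Hh : h y = h m := by
    rcases le_or_gt y 0 with c | c
    · rw [← bot y h5 c]; exact G _ (by omega) (by omega)
    · have := top (y-1) (by omega) (by omega)
      rw [sub_add_cancel] at this
      rw [← this]; exact G _ (by omega) (by omega)
  rw [dec x y hx hy h1 h2 h3 h4 h5, Hh, G x hx (by omega), two]

/-- sum over the four neighbours -/
def nbr (f : ℤ × ℤ → ZMod 2) (x : ℤ × ℤ) : ZMod 2 :=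
  f (x.1+1, x.2) + f (x.1-1, x.2) + f (x.1, x.2+1) + f (x.1, x.2-1)

theorem adj_color {a b : ℤ × ℤ} {q : ℤ} (h : Adjacent a b) :
    Even (a.1 + a.2 - q) ↔ ¬ Even (b.1 + b.2 - q) := by
  unfold Adjacent at h
  rw [Int.even_iff, Int.even_iff]
  omega

theorem adj_symm {a b : ℤ × ℤ} (h : Adjacent a b) : Adjacent b a := by
  unfold Adjacent at *
  omega

theorem disj_eq {R : Set (ℤ × ℤ)} {T : Set (Set (ℤ × ℤ))} (hT : IsDominoTiling R T)
    {d e : Set (ℤ × ℤ)} (hd : d ∈ T) (he : e ∈ T) {x : ℤ × ℤ} (h1 : x ∈ d) (h2 : x ∈ e) :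
    d = e := by
  by_contra hne
  exact Set.disjoint_left.1 (hT.2.1 hd he hne) h1 h2

theorem partner {R : Set (ℤ × ℤ)} {T : Set (Set (ℤ × ℤ))} (hT : IsDominoTiling R T)
    {x : ℤ × ℤ} (hx : x ∈ R) : ∃ y ∈ R, Adjacent y x ∧ ({y, x} : Set (ℤ × ℤ)) ∈ T := by
  rw [← hT.2.2] at hx
  obtain ⟨d, hd, hxd⟩ := hx
  obtain ⟨a, b, hab, rfl⟩ := hT.1 d hd
  have hR : ∀ z ∈ ({a, b} : Set (ℤ × ℤ)), z ∈ R := fun z hz => hT.2.2 ▸ ⟨_, hd, hz⟩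
  rcases hxd with h | h
  · subst h
    exact ⟨b, hR _ (by simp), adj_symm hab, by rwa [Set.pair_comm]⟩
  · rw [Set.mem_singleton_iff] at h
    subst h
    exact ⟨a, hR _ (by simp), hab, hd⟩

theorem card_tilings (R : Set (ℤ × ℤ)) (hR : R.Finite) (q : ℤ) (ρ : ℤ × ℤ → ℤ × ℤ)
    (hρ : ∀ x, ρ (ρ x) = x) (hρR : ∀ x ∈ R, ρ x ∈ R)
    (hρc : ∀ x, Even ((ρ x).1 + (ρ x).2 - q) ↔ ¬ Even (x.1 + x.2 - q)) :
    numTilings R = Nat.card {σ : Equiv.Perm {x : ℤ × ℤ // x ∈ R ∧ Even (x.1 + x.2 - q)} //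
      ∀ v, Adjacent (σ v).1 (ρ v.1)} := by
  have : Finite {x : ℤ × ℤ // x ∈ R ∧ Even (x.1 + x.2 - q)} :=
    (hR.subset (fun x hx => hx.1 : {x | x ∈ R ∧ Even (x.1 + x.2 - q)} ⊆ R)).to_subtype
  have hinj : ∀ x y, ρ x = ρ y → x = y := fun x y h => by rw [← hρ x, h, hρ]
  have hne : ∀ v w : {x : ℤ × ℤ // x ∈ R ∧ Even (x.1 + x.2 - q)}, v.1 ≠ ρ w.1 := by
    intro v w h
    have := (hρc w.1).1 (h ▸ v.2.2)
    exact this w.2.2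
  unfold numTilings
  symm
  refine Nat.card_congr (Equiv.ofBijective
    (fun σ => ⟨{d | ∃ v, d = {(σ.1 v).1, ρ v.1}}, ?_⟩) ⟨?_, ?_⟩)
  · obtain ⟨σ, hσ⟩ := σ
    refine ⟨?_, ?_, ?_⟩
    · rintro d ⟨v, rfl⟩
      exact ⟨_, _, hσ v, rfl⟩
    · rintro d ⟨v, rfl⟩ e ⟨u, rfl⟩ hde
      have huv : v ≠ u := fun h => hde (by rw [h])
      refine Set.disjoint_left.2 ?_
      intro x hx hx'
      simp only [id, Set.mem_insert_iff, Set.mem_singleton_iff] at hx hx'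
      rcases hx with hx | hx <;> rcases hx' with hx' | hx'
      · exact huv (σ.injective (Subtype.ext (hx.symm.trans hx')))
      · exact hne _ _ (hx.symm.trans hx')
      · exact hne _ _ (hx'.symm.trans hx)
      · exact huv (Subtype.ext (hinj _ _ (hx.symm.trans hx')))
    · ext x
      constructor
      · rintro ⟨d, ⟨v, rfl⟩, hx⟩
        rcases hx with hx | hx
        · rw [hx]; exact (σ v).2.1
        · rw [Set.mem_singleton_iff] at hx
          rw [hx]; exact hρR _ v.2.1
      · intro hx
        by_cases hc : Even (x.1 + x.2 - q)
        · exact ⟨_, ⟨σ.symm ⟨x, hx, hc⟩, rfl⟩, by simp⟩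
        · exact ⟨_, ⟨⟨ρ x, hρR x hx, (hρc x).2 hc⟩, rfl⟩, by simp [hρ]⟩
  · rintro ⟨σ, hσ⟩ ⟨τ, hτ⟩ h
    simp only [Subtype.mk.injEq] at h
    apply Subtype.ext
    apply Equiv.ext
    intro v
    have h1 : ({(σ v).1, ρ v.1} : Set (ℤ × ℤ)) ∈
        {d : Set (ℤ × ℤ) | ∃ v, d = {(τ v).1, ρ v.1}} := by
      rw [← h]; exact ⟨v, rfl⟩
    obtain ⟨u, hu⟩ := h1
    have h2 : ρ v.1 ∈ ({(τ u).1, ρ u.1} : Set (ℤ × ℤ)) := by rw [← hu]; simp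
    have h3 : (σ v).1 ∈ ({(τ u).1, ρ u.1} : Set (ℤ × ℤ)) := by rw [← hu]; simp
    have huv : v = u := by
      rcases h2 with h2 | h2
      · exact absurd h2.symm (hne _ _)
      · exact Subtype.ext (hinj _ _ h2)
    subst huv
    rcases h3 with h3 | h3
    · exact Subtype.ext h3
    · exact absurd h3 (hne _ _)
  · rintro ⟨T, hT⟩
    have ex : ∀ v : {x : ℤ × ℤ // x ∈ R ∧ Even (x.1 + x.2 - q)},
        ∃ w : {x : ℤ × ℤ // x ∈ R ∧ Even (x.1 + x.2 - q)},
          Adjacent w.1 (ρ v.1) ∧ ({w.1, ρ v.1} : Set (ℤ × ℤ)) ∈ T := by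
      intro v
      obtain ⟨y, hy, ha, hyT⟩ := partner hT (hρR _ v.2.1)
      refine ⟨⟨y, hy, (adj_color ha).2 ?_⟩, ha, hyT⟩
      intro hc
      exact (hρc v.1).1 hc v.2.2
    choose s hs1 hs2 using ex
    have sinj : Function.Injective s := by
      intro v u h
      have := disj_eq hT (hs2 v) (hs2 u) (x := (s v).1) (by simp) (by simp [h])
      have h2 : ρ v.1 ∈ ({(s u).1, ρ u.1} : Set (ℤ × ℤ)) := by rw [← this]; simp
      rcases h2 with h2 | h2
      · exact absurd h2.symm (hne _ _)
      · exact Subtype.ext (hinj _ _ h2)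
    refine ⟨⟨Equiv.ofBijective s (Finite.injective_iff_bijective.1 sinj), hs1⟩, ?_⟩
    apply Subtype.ext
    ext d
    constructor
    · rintro ⟨v, rfl⟩
      exact hs2 v
    · intro hd
      obtain ⟨a, b, hab, rfl⟩ := hT.1 d hd
      have hR : ∀ z ∈ ({a, b} : Set (ℤ × ℤ)), z ∈ R := fun z hz => hT.2.2 ▸ ⟨_, hd, hz⟩
      have fin : ∀ x ∈ ({a, b} : Set (ℤ × ℤ)), ¬ Even (x.1 + x.2 - q) →
          ∃ v, ({a, b} : Set (ℤ × ℤ)) = {(s v).1, ρ v.1} := by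
        intro x hx hc
        refine ⟨⟨ρ x, hρR x (hR x hx), (hρc x).2 hc⟩, ?_⟩
        exact disj_eq hT hd (hs2 _) hx (by simp [hρ])
      by_cases hc : Even (a.1 + a.2 - q)
      · exact fin b (by simp) ((adj_color hab).1 hc)
      · exact fin a (by simp) hc

theorem odd_of_ker (R : Set (ℤ × ℤ)) (hR : R.Finite) (q : ℤ) (ρ : ℤ × ℤ → ℤ × ℤ)
    (hρ : ∀ x, ρ (ρ x) = x) (hρR : ∀ x ∈ R, ρ x ∈ R)
    (hρc : ∀ x, Even ((ρ x).1 + (ρ x).2 - q) ↔ ¬ Even (x.1 + x.2 - q))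
    (ker : ∀ f : ℤ × ℤ → ZMod 2, (∀ x, ¬ (x ∈ R ∧ Even (x.1 + x.2 - q)) → f x = 0) →
      (∀ x ∈ R, ¬ Even (x.1 + x.2 - q) → nbr f x = 0) →
      ∀ x, x ∈ R → Even (x.1 + x.2 - q) → f x = 0) :
    Odd (numTilings R) := by
  classical
  rw [card_tilings R hR q ρ hρ hρR hρc]
  have : Finite {x : ℤ × ℤ // x ∈ R ∧ Even (x.1 + x.2 - q)} :=
    (hR.subset (fun x hx => hx.1 : {x | x ∈ R ∧ Even (x.1 + x.2 - q)} ⊆ R)).to_subtype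
  have : Fintype {x : ℤ × ℤ // x ∈ R ∧ Even (x.1 + x.2 - q)} := Fintype.ofFinite _
  let N : Matrix {x : ℤ × ℤ // x ∈ R ∧ Even (x.1 + x.2 - q)}
    {x : ℤ × ℤ // x ∈ R ∧ Even (x.1 + x.2 - q)} (ZMod 2) :=
    fun w v => if Adjacent w.1 (ρ v.1) then 1 else 0
  have hdet : N.det ≠ 0 := by
    intro h0
    obtain ⟨v, hv, hvN⟩ := Matrix.exists_vecMul_eq_zero_iff.2 h0
    apply hv
    let f : ℤ × ℤ → ZMod 2 := fun x => if h : x ∈ R ∧ Even (x.1 + x.2 - q) then v ⟨x, h⟩ else 0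
    have hf : ∀ w : {x : ℤ × ℤ // x ∈ R ∧ Even (x.1 + x.2 - q)}, f w.1 = v w := by
      intro w
      simp only [f]
      rw [dif_pos w.2]
    have hf0 : ∀ x, ¬ (x ∈ R ∧ Even (x.1 + x.2 - q)) → f x = 0 := by
      intro x hx
      simp only [f]
      rw [dif_neg hx]
    have hs : ∀ y : ℤ × ℤ, ∑ w : {x : ℤ × ℤ // x ∈ R ∧ Even (x.1 + x.2 - q)},
        v w * (if w.1 = y then 1 else 0) = f y := by
      intro y
      by_cases hy : y ∈ R ∧ Even (y.1 + y.2 - q)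
      · rw [Finset.sum_eq_single ⟨y, hy⟩]
        · simp [← hf]
        · intro b _ hb
          rw [if_neg, mul_zero]
          intro h
          exact hb (Subtype.ext h)
        · simp
      · rw [hf0 y hy]
        apply Finset.sum_eq_zero
        intro w _
        rw [if_neg, mul_zero]
        rintro rfl
        exact hy w.2
    funext w
    rw [← hf w]
    refine ker f hf0 ?_ w.1 w.2.1 w.2.2
    intro x hx hc
    have h1 := congrFun hvN ⟨ρ x, hρR x hx, (hρc x).2 hc⟩
    simp only [Matrix.vecMul, dotProduct, N, hρ, Pi.zero_apply] at h1
    rw [← h1, nbr, ← hs, ← hs, ← hs, ← hs, ← Finset.sum_add_distrib, ← Finset.sum_add_distrib,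
      ← Finset.sum_add_distrib]
    apply Finset.sum_congr rfl
    rintro ⟨⟨a, b⟩, hw⟩ _
    obtain ⟨c, d⟩ := x
    rw [← mul_add, ← mul_add, ← mul_add]
    congr 1
    by_cases hA : Adjacent (a, b) (c, d)
    · rw [if_pos hA]
      simp only [Adjacent] at hA
      simp only [Prod.mk.injEq]
      split_ifs <;> first | omega | simp
    · rw [if_neg hA]
      simp only [Adjacent] at hA
      simp only [Prod.mk.injEq]
      split_ifs <;> first | omega | simp
  rw [Nat.card_eq_fintype_card, Fintype.card_subtype]
  rw [← ZMod.natCast_ne_zero_iff_odd]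
  convert hdet using 1
  rw [Matrix.det_apply, Finset.natCast_card_filter]
  apply Finset.sum_congr rfl
  intro σ _
  have hsg : ∀ z : ZMod 2, Equiv.Perm.sign σ • z = z := by
    intro z
    rcases Int.units_eq_one_or (Equiv.Perm.sign σ) with h | h <;> rw [h]
    · simp
    · revert z; decide
  rw [hsg]
  simp only [N]
  rw [Finset.prod_ite_zero]
  simp

theorem Treg_finite (i j p : ℕ) : (Treg i j p).Finite := by
  refine (Set.finite_Icc ((0 : ℤ), (0 : ℤ)) ((p + j + p : ℤ), (i + p : ℤ))).subset ?_
  rintro ⟨c, r⟩ h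
  simp only [Treg, Set.mem_ofPred_eq] at h
  simp only [Set.mem_Icc, Prod.mk_le_mk]
  omega

theorem odd_case (k p : ℕ) (hp : 0 < p) (hk : Odd k) :
    Odd (numTilings (Treg k (k + 1) p)) := by
  obtain ⟨n, rfl⟩ := hk
  refine odd_of_ker _ (Treg_finite _ _ _) (p - 1) (fun x => (2*p + (2*n+1) - 2 - x.1, x.2))
    ?_ ?_ ?_ ?_
  · rintro ⟨c, r⟩; simp
  · rintro ⟨c, r⟩ h
    simp only [Treg, Set.mem_ofPred_eq] at h ⊢
    push_cast at h ⊢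
    omega
  · rintro ⟨c, r⟩
    simp only [Int.even_iff]
    omega
  · intro f f0 hrel ⟨c, r⟩ hx hc
    have z : ∀ c r, (c, r) ∉ Treg (2*n+1) (2*n+1+1) p → f (c, r) = 0 :=
      fun c r h => f0 _ (fun h' => h h'.1)
    simp only [Treg, Set.mem_ofPred_eq] at z hx
    push_cast at z hx
    have hev := hc
    simp only [Int.even_iff] at hc
    obtain ⟨x, y, rfl, rfl⟩ : ∃ x y : ℤ, c = p - 1 + x + y ∧ r = x - y :=
      ⟨(c + r - (p-1))/2, (c - r - (p-1))/2, by omega, by omega⟩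
    refine ker_odd (n+1) p (by omega) (by omega) (fun x y => f (p - 1 + x + y, x - y))
      ?_ ?_ ?_ ?_ ?_ ?_ x y ?_ ?_ ?_ ?_ ?_ ?_ ?_
    · intro x y h1 h2 h3 h4 h5 h6
      have := hrel (p + x + y, x - y) ?_ ?_
      · rw [← this]
        simp only [nbr]
        ring_nf
      · simp only [Treg, Set.mem_ofPred_eq]
        push_cast
        omega
      · simp only [Int.even_iff]
        omega
    · intro x y h; apply z; omega
    · intro x y h; apply z; omega
    · intro x y h; apply z; omega
    · intro x y h; apply z; omega
    · intro x y h h'; apply z; omega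
    all_goals omega

theorem rect_case (k : ℕ) (hk : Even k) : Odd (numTilings (Treg k (k + 1) 1)) := by
  obtain ⟨n, rfl⟩ := hk
  refine odd_of_ker _ (Treg_finite _ _ _) 0 (fun x => (x.1, n + n - 1 - x.2)) ?_ ?_ ?_ ?_
  · rintro ⟨c, r⟩; simp
  · rintro ⟨c, r⟩ h
    simp only [Treg, Set.mem_ofPred_eq] at h ⊢
    push_cast at h ⊢
    omega
  · rintro ⟨c, r⟩
    simp only [Int.even_iff]
    omega
  · intro f f0 hrel
    have z : ∀ c r, (c, r) ∉ Treg (n+n) (n+n+1) 1 → f (c, r) = 0 :=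
      fun c r h => f0 _ (fun h' => h h'.1)
    have zc : ∀ c r : ℤ, ¬ Even (c + r) → f (c, r) = 0 :=
      fun c r h => f0 _ (fun h' => h (by simpa using h'.2))
    have rel : ∀ c r : ℤ, 0 ≤ c → c ≤ n + n → 0 ≤ r → r ≤ n + n - 1 → nbr f (c, r) = 0 := by
      intro c r h1 h2 h3 h4
      by_cases hc : Even (c + r)
      · simp only [nbr]
        rw [Int.even_iff] at hc
        rw [zc, zc, zc, zc]
        · simp
        all_goals rw [Int.even_iff]; omega
      · apply hrel
        · simp only [Treg, Set.mem_ofPred_eq]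
          push_cast
          omega
        · simpa using hc
    simp only [Treg, Set.mem_ofPred_eq] at z
    push_cast at z
    have last : ∀ r : ℤ, f (n+n, r) = 0 := by
      intro r
      by_cases hr : 0 ≤ r ∧ r ≤ n + n - 1
      · have := rect_sum' (fun i j => f (-1 + i + j, n + n - r - 1 + i - j)) 0 0 (r+1) (n+n-r)
          (by omega) (by omega) ?_
        · beta_reduce at this
          rw [z _ _ (by omega), z _ _ (by omega), z _ _ (by omega)] at this
          rw [zero_add, zero_add, zero_add] at this
          rw [← this]; ring_nf
        · intro i j h1 h2 h3 h4
          rw [← rel (i + j) (n+n-r-1+i-j) (by omega) (by omega) (by omega) (by omega)]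
          simp only [nbr]
          ring_nf
      · apply z; omega
    have all : ∀ t : ℕ, t ≤ n + n + 1 → ∀ r, f (n+n-t, r) = 0 ∧ f (n+n-t+1, r) = 0 := by
      intro t
      induction t with
      | zero =>
        intro _ r
        refine ⟨by simpa using last r, ?_⟩
        apply z
        push_cast
        omega
      | succ t ih =>
        intro ht r
        have ih := ih (by omega)
        have e : (n + n - ((t+1 : ℕ) : ℤ) + 1) = n + n - t := by push_cast; ring
        rw [e]
        refine ⟨?_, (ih r).1⟩
        by_cases hr : 0 ≤ r ∧ r ≤ n + n - 1
        · have := rel (n+n-t) r (by omega) (by omega) (by omega) (by omega)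
          simp only [nbr] at this
          rw [(ih _).1, (ih _).1, (ih _).2] at this
          rw [zero_add, add_zero, add_zero] at this
          rw [← this]; push_cast; ring_nf
        · apply z; omega
    rintro ⟨c, r⟩ hx _
    simp only [Treg, Set.mem_ofPred_eq] at hx
    push_cast at hx
    have := (all (n+n-c).toNat (by omega) r).1
    rw [← this]
    congr 2
    omega

theorem even_case (k p : ℕ) (hp : 1 < p) (hk : Even k) :
    numTilings (Treg k (k + 1) p) = 0 := by
  obtain ⟨n, rfl⟩ := hk
  unfold numTilings
  rw [Nat.card_eq_zero]
  left
  refine ⟨fun ⟨T, hT⟩ => ?_⟩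
  set R := Treg (n+n) (n+n+1) p with hRdef
  let q : ℤ := p - 1
  have : Finite {x : ℤ × ℤ // x ∈ R ∧ Even (x.1 + x.2 - q)} :=
    ((Treg_finite (n+n) (n+n+1) p).subset
      (fun x hx => hx.1 : {x | x ∈ R ∧ Even (x.1 + x.2 - q)} ⊆ R)).to_subtype
  let ψ : ℤ × ℤ → ℤ × ℤ := fun x => if x.2 < q then (x.1 - 1, x.2) else
    if Even (x.2 - q) then (x.1, x.2 + 1) else (x.1, x.2 - 1)
  have ψmem : ∀ x ∈ R, ¬ Even (x.1 + x.2 - q) → ψ x ∈ R ∧ Even ((ψ x).1 + (ψ x).2 - q) := by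
    rintro ⟨c, r⟩ hx hc
    simp only [hRdef, Treg, Set.mem_ofPred_eq, ψ, q, Int.even_iff] at hx hc ⊢
    push_cast at hx ⊢
    split_ifs <;> simp only [] <;> omega
  have ψinj : ∀ x y, ψ x = ψ y → x = y := by
    rintro ⟨c, r⟩ ⟨c', r'⟩ h
    simp only [ψ, q, Int.even_iff] at h
    split_ifs at h <;> simp only [Prod.mk.injEq] at h ⊢ <;> omega
  have ex : ∀ v : {x : ℤ × ℤ // x ∈ R ∧ Even (x.1 + x.2 - q)},
      ∃ b ∈ R, ¬ Even (b.1 + b.2 - q) ∧ ({b, v.1} : Set (ℤ × ℤ)) ∈ T := by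
    intro v
    obtain ⟨y, hy, ha, hyT⟩ := partner hT v.2.1
    exact ⟨y, hy, (adj_color (adj_symm ha)).1 v.2.2, hyT⟩
  choose s hs1 hs2 hs3 using ex
  let F : {x : ℤ × ℤ // x ∈ R ∧ Even (x.1 + x.2 - q)} →
      {x : ℤ × ℤ // x ∈ R ∧ Even (x.1 + x.2 - q)} := fun v => ⟨ψ (s v), ψmem _ (hs1 v) (hs2 v)⟩
  have Finj : Function.Injective F := by
    intro v u h
    have h := ψinj _ _ (congrArg Subtype.val h)
    have := disj_eq hT (hs3 v) (hs3 u) (x := s v) (by simp) (by simp [h])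
    have h2 : v.1 ∈ ({s u, u.1} : Set (ℤ × ℤ)) := by rw [← this]; simp
    rcases h2 with h2 | h2
    · exact absurd (h2 ▸ v.2.2) (hs2 u)
    · exact Subtype.ext h2
  obtain ⟨v, hv⟩ := (Finite.injective_iff_surjective.1 Finj) ⟨(p + n + n - 1, 0), by
    simp only [hRdef, Treg, Set.mem_ofPred_eq, q, Int.even_iff]
    push_cast
    refine ⟨⟨trivial, ?_⟩, ?_⟩ <;> omega⟩
  have hv := congrArg Subtype.val hv
  have h1 := hs1 v
  simp only [F] at hv
  generalize s v = b at *
  obtain ⟨c, r⟩ := b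
  simp only [hRdef, Treg, Set.mem_ofPred_eq] at h1
  push_cast at h1
  simp only [ψ, q, Int.even_iff] at hv
  split_ifs at hv <;> simp only [Prod.mk.injEq] at hv <;> omega

theorem T_k_k1_parity (k p : ℕ) (hk : 0 < k) (hp : 0 < p) :
    ((1 < p ∧ Even k) → Even (numTilings (Treg k (k + 1) p))) ∧
    ((p = 1 ∨ Odd k) → Odd (numTilings (Treg k (k + 1) p))) := by
  refine ⟨fun ⟨h1, h2⟩ => by rw [even_case k p h1 h2]; exact Even.zero, ?_⟩
  intro h
  rcases Nat.even_or_odd k with he | ho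
  · rcases h with rfl | h
    · exact rect_case k he
    · exact absurd he (Nat.not_even_iff_odd.2 h)
  · exact odd_case k p hp ho
end

section
/- For all positive integers k and p, the number of domino tilings of the region D(k,k,p) is even. -/
/-- The region `D(i,j,p)`: rows `r = 0, …, i+2p-3` from top to bottom of lengths
`j, j+2, …, j+2(p-2)`, then `i` rows of length `j+2(p-1)`, then `j+2(p-2), …, j+2, j`,
centers aligned. -/
def Dreg (i j p : ℕ) : Set (ℤ × ℤ) :=
  {q | 0 ≤ q.2 ∧ q.2 ≤ (i : ℤ) + 2 * p - 3 ∧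
    (p : ℤ) - 1 - min (min q.2 ((p : ℤ) - 1)) ((i : ℤ) + 2 * p - 3 - q.2) ≤ q.1 ∧
    q.1 ≤ (p : ℤ) - 2 + j + min (min q.2 ((p : ℤ) - 1)) ((i : ℤ) + 2 * p - 3 - q.2)}

theorem Dreg_swap (k p : ℕ) (q : ℤ × ℤ) : q.swap ∈ Dreg k k p ↔ q ∈ Dreg k k p := by
  obtain ⟨a, b⟩ := q
  simp only [Dreg, Set.mem_setOf_eq, Prod.swap]
  omega

def flipT (T : Set (Set (ℤ × ℤ))) : Set (Set (ℤ × ℤ)) := {d | Prod.swap ⁻¹' d ∈ T}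

theorem flipT_flipT (T : Set (Set (ℤ × ℤ))) : flipT (flipT T) = T := rfl

theorem flipT_tiling (R : Set (ℤ × ℤ)) (hR : ∀ q : ℤ × ℤ, q.swap ∈ R ↔ q ∈ R)
    (T : Set (Set (ℤ × ℤ))) (h : IsDominoTiling R T) : IsDominoTiling R (flipT T) := by
  obtain ⟨h1, h2, h3⟩ := h
  refine ⟨?_, ?_, ?_⟩
  · intro d hd
    obtain ⟨a, b, hab, he⟩ := h1 _ hd
    refine ⟨a.swap, b.swap, ?_, ?_⟩
    · simp only [Adjacent, Prod.fst_swap, Prod.snd_swap] at hab ⊢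
      tauto
    · ext x
      have hx : x.swap ∈ Prod.swap ⁻¹' d ↔ x.swap ∈ ({a, b} : Set (ℤ × ℤ)) := by rw [he]
      simp only [Set.mem_preimage, Prod.swap_swap, Set.mem_insert_iff,
        Set.mem_singleton_iff] at hx ⊢
      rw [hx, Prod.swap_eq_iff_eq_swap, Prod.swap_eq_iff_eq_swap]
  · intro d hd e he hne
    have hne' : Prod.swap ⁻¹' d ≠ Prod.swap ⁻¹' e := by
      intro h
      exact hne (Prod.swap_surjective.preimage_injective h)
    have := h2 hd he hne'
    simp only [Function.onFun, id, Set.disjoint_left] at this ⊢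
    intro x hx hx'
    exact this (a := x.swap) (by simpa using hx) (by simpa using hx')
  · ext x
    rw [← hR, ← h3]
    constructor
    · rintro ⟨d, hd, hx⟩
      exact ⟨_, hd, by simpa using hx⟩
    · rintro ⟨d, hd, hx⟩
      exact ⟨Prod.swap ⁻¹' d, hd, hx⟩

theorem flipT_ne (R : Set (ℤ × ℤ)) (x : ℤ) (hx : (x, x) ∈ R)
    (T : Set (Set (ℤ × ℤ))) (h : IsDominoTiling R T) : flipT T ≠ T := by
  intro hf
  obtain ⟨h1, h2, h3⟩ := h
  rw [← h3] at hx
  obtain ⟨d, hd, hxd⟩ := hx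
  have hd' : Prod.swap ⁻¹' d ∈ T := by
    have : d ∈ flipT T := by rw [hf]; exact hd
    exact this
  have heq : Prod.swap ⁻¹' d = d := by
    by_contra hne
    have hdis := h2 hd' hd hne
    simp only [Function.onFun, id, Set.disjoint_left] at hdis
    exact hdis (a := (x, x)) hxd hxd
  obtain ⟨⟨a1, a2⟩, ⟨b1, b2⟩, hab, rfl⟩ := h1 d hd
  have ha : ((a1, a2) : ℤ × ℤ) ∈ Prod.swap ⁻¹' ({(a1, a2), (b1, b2)} : Set (ℤ × ℤ)) := by
    rw [heq]; simp
  have hb : ((b1, b2) : ℤ × ℤ) ∈ Prod.swap ⁻¹' ({(a1, a2), (b1, b2)} : Set (ℤ × ℤ)) := by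
    rw [heq]; simp
  simp only [Adjacent, Set.mem_preimage, Prod.swap, Set.mem_insert_iff, Set.mem_singleton_iff,
    Prod.mk.injEq] at *
  omega

theorem even_card_of_invol {α : Type*} (f : α → α) (hf : ∀ x, f (f x) = x) (hn : ∀ x, f x ≠ x) :
    Even (Nat.card α) := by
  classical
  rcases finite_or_infinite α with _ | _
  · have := Fintype.ofFinite α
    have : Fact (Nat.Prime 2) := ⟨Nat.prime_two⟩
    have h := Equiv.Perm.card_fixedPoints_modEq (f := (f : Function.End α)) (p := 2) (n := 1)
      (by
        have h2 : (show Function.End α from f) ^ 2 ^ 1 = (show Function.End α from f) * (show Function.End α from f) := pow_two _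
        exact h2.trans (funext hf))
    have : IsEmpty (Function.fixedPoints f) := ⟨fun x => hn x.1 x.2⟩
    rw [Nat.card_eq_fintype_card, Nat.even_iff]
    rw [Fintype.card_eq_zero (α := Function.fixedPoints f)] at h
    exact h
  · simp

theorem D_k_k_even (k p : ℕ) (hk : 0 < k) (hp : 0 < p) :
    Even (numTilings (Dreg k k p)) := by
  refine even_card_of_invol
    (fun T => ⟨flipT T.1, flipT_tiling _ (Dreg_swap k p) T.1 T.2⟩) (fun T => rfl) ?_
  intro T h
  refine flipT_ne _ ((p : ℤ) - 1) ?_ T.1 T.2 (congrArg Subtype.val h)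
  simp only [Dreg, Set.mem_setOf_eq]
  omega
end
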